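/- For every $q\in\mathbb{R}$ and every $\varepsilon>0$, $\mathscr{H}^{q,\underline{\tau}_\mu(q)-\varepsilon}_\nu([0,1])>0$; consequently $b_\nu(q)\ge\underline{\tau}_\mu(q)$. -/

import Mathlib

open MeasureTheory Metric Set Filter Topology Classical
open scoped ENNReal NNReal

noncomputable section

namespace MF

/-! ### Olsen's multifractal measures and dimension functions on a metric space -/

variable {X : Type} [MetricSpace X]

/-- The sum `∑ m(B(xᵢ,rᵢ))^q (2rᵢ)^t` associated with a countable family of centered balls. -/
def olsenSum [MeasurableSpace X] (m : Measure X) (q t : ℝ) {ι : Type}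
    (c : ι → X) (r : ι → ℝ) : ℝ≥0∞ :=
  ∑' i, m (closedBall (c i) (r i)) ^ q * ENNReal.ofReal (2 * r i) ^ t

/-- `Olsen's 𝓗^{q,t}_{m,δ}`: infimum over countable centered `δ`-coverings of `E`. -/
def Hdel [MeasurableSpace X] (m : Measure X) (q t δ : ℝ) (E : Set X) : ℝ≥0∞ :=
  ⨅ (ι : Type) (_ : Countable ι) (c : ι → X) (r : ι → ℝ)
    (_ : ∀ i, c i ∈ E) (_ : ∀ i, 0 < r i ∧ r i ≤ δ)
    (_ : E ⊆ ⋃ i, closedBall (c i) (r i)), olsenSum m q t c r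

/-- Olsen's premeasure `𝓗̄^{q,t}_m` (limit, i.e. supremum, as `δ ↓ 0`). -/
def Hpre [MeasurableSpace X] (m : Measure X) (q t : ℝ) (E : Set X) : ℝ≥0∞ :=
  ⨆ (δ : ℝ) (_ : 0 < δ), Hdel m q t δ E

/-- Olsen's multifractal Hausdorff measure `𝓗^{q,t}_m`. -/
def Hmeas [MeasurableSpace X] (m : Measure X) (q t : ℝ) (E : Set X) : ℝ≥0∞ :=
  ⨆ (F : Set X) (_ : F ⊆ E), Hpre m q t F

/-- `𝓟̄^{q,t}_{m,δ}`: supremum over countable centered `δ`-packings of `E`. -/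
def Pdel [MeasurableSpace X] (m : Measure X) (q t δ : ℝ) (E : Set X) : ℝ≥0∞ :=
  ⨆ (ι : Type) (_ : Countable ι) (c : ι → X) (r : ι → ℝ)
    (_ : ∀ i, c i ∈ E) (_ : ∀ i, 0 < r i ∧ r i ≤ δ)
    (_ : ∀ i j, i ≠ j → Disjoint (closedBall (c i) (r i)) (closedBall (c j) (r j))),
    olsenSum m q t c r

/-- Olsen's packing premeasure `𝓟̄^{q,t}_m` (limit, i.e. infimum, as `δ ↓ 0`). -/
def Ppre [MeasurableSpace X] (m : Measure X) (q t : ℝ) (E : Set X) : ℝ≥0∞ :=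
  ⨅ (δ : ℝ) (_ : 0 < δ), Pdel m q t δ E

/-- Olsen's multifractal packing measure `𝓟^{q,t}_m`. -/
def Pmeas [MeasurableSpace X] (m : Measure X) (q t : ℝ) (E : Set X) : ℝ≥0∞ :=
  ⨅ (En : ℕ → Set X) (_ : E ⊆ ⋃ n, En n), ∑' n, Ppre m q t (En n)

/-- The (topological) support of a measure on a metric space. -/
def msupport [MeasurableSpace X] (m : Measure X) : Set X :=
  {x | ∀ r : ℝ, 0 < r → 0 < m (ball x r)}

/-- Olsen's multifractal Hausdorff dimension function `b_m`. -/
def bFun [MeasurableSpace X] (m : Measure X) (q : ℝ) : ℝ :=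
  sInf {t | Hmeas m q t (msupport m) = 0}

/-- Olsen's multifractal packing dimension function `B_m`. -/
def BFun [MeasurableSpace X] (m : Measure X) (q : ℝ) : ℝ :=
  sInf {t | Pmeas m q t (msupport m) = 0}

/-- Olsen's function `τ_m`. -/
def tauFun [MeasurableSpace X] (m : Measure X) (q : ℝ) : ℝ :=
  sInf {t | Ppre m q t (msupport m) = 0}

/-- `t`-dimensional packing pre-premeasure at scale `δ`. -/
def pPdel (t δ : ℝ) (E : Set X) : ℝ≥0∞ :=
  ⨆ (ι : Type) (_ : Countable ι) (c : ι → X) (r : ι → ℝ)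
    (_ : ∀ i, c i ∈ E) (_ : ∀ i, 0 < r i ∧ r i ≤ δ)
    (_ : ∀ i j, i ≠ j → Disjoint (closedBall (c i) (r i)) (closedBall (c j) (r j))),
    ∑' i, ENNReal.ofReal (2 * r i) ^ t

/-- `t`-dimensional packing premeasure. -/
def pPpre (t : ℝ) (E : Set X) : ℝ≥0∞ := ⨅ (δ : ℝ) (_ : 0 < δ), pPdel t δ E

/-- `t`-dimensional packing measure. -/
def pPmeas (t : ℝ) (E : Set X) : ℝ≥0∞ :=
  ⨅ (En : ℕ → Set X) (_ : E ⊆ ⋃ n, En n), ∑' n, pPpre t (En n)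

/-- Packing dimension of a set. -/
def packDim (E : Set X) : ℝ := sInf {t | pPmeas t E = 0}

/-- The level set `X_m(α)` of points of the support where the local Hölder exponent is `α`. -/
def Xlev [MeasurableSpace X] (m : Measure X) (α : ℝ) : Set X :=
  {x | x ∈ msupport m ∧
    Tendsto (fun r => Real.log (m (closedBall x r)).toReal / Real.log r)
      (𝓝[>] (0 : ℝ)) (𝓝 α)}

/-- Legendre transform `f^*(x) = inf_y (xy + f(y))`. -/
def leg (f : ℝ → ℝ) (x : ℝ) : ℝ := ⨅ y : ℝ, (x * y + f y)

/-! ### The mixed symbolic space and inhomogeneous multinomial measures -/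

/-- `j` is an index governed by the first alphabet:
`T (2k-1) ≤ j < T (2k)` for some `k ≥ 1`. -/
def isA (T : ℕ → ℕ) (j : ℕ) : Prop :=
  ∃ k, 1 ≤ k ∧ T (2 * k - 1) ≤ j ∧ j < T (2 * k)

/-- The size of the alphabet at (0-based) position `n`, i.e. at paper index `j = n+1`. -/
def Yc (c₁ c₂ : ℕ) (T : ℕ → ℕ) (n : ℕ) : ℕ := if isA T (n + 1) then c₁ else c₂

/-- The mixed symbolic space `∂𝒜₁,₂* = ∏ⱼ Yⱼ`. -/
abbrev Omg (c₁ c₂ : ℕ) (T : ℕ → ℕ) : Type := ∀ n : ℕ, Fin (Yc c₁ c₂ T n)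

/-- Finite words of length `n`. -/
abbrev Word (c₁ c₂ : ℕ) (T : ℕ → ℕ) (n : ℕ) : Type :=
  ∀ i : Fin n, Fin (Yc c₁ c₂ T i.val)

/-- `N_n`: the number of indices `1 ≤ j ≤ n` governed by the first alphabet. -/
def Ncount (T : ℕ → ℕ) (n : ℕ) : ℕ := ((Finset.Icc 1 n).filter (isA T)).card

/-- Diameter `c₁^{-N_n} c₂^{-(n-N_n)}` of a cylinder of generation `n`. -/
def Dw (c₁ c₂ : ℕ) (T : ℕ → ℕ) (n : ℕ) : ℝ :=
  ((c₁ : ℝ) ^ Ncount T n * (c₂ : ℝ) ^ (n - Ncount T n))⁻¹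

/-- The cylinder `[w]` defined by a finite word `w`. -/
def cyl (c₁ c₂ : ℕ) (T : ℕ → ℕ) (n : ℕ) (w : Word c₁ c₂ T n) : Set (Omg c₁ c₂ T) :=
  {x | ∀ i : Fin n, x i.val = w i}

/-- The mass `∏_{j≤n} p_j` given to the cylinder `[w]` by the inhomogeneous
multinomial measure with weights `a` and `b`. -/
def cylWeight (c₁ c₂ : ℕ) (T : ℕ → ℕ) (a b : ℕ → ℝ) (n : ℕ) (w : Word c₁ c₂ T n) : ℝ :=
  ∏ i : Fin n, (if isA T (i.val + 1) then a (w i).val else b (w i).val)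

/-- `θ(q) = log_c (p₁^q + ⋯ + p_c^q)`. -/
def theta (c : ℕ) (p : ℕ → ℝ) (q : ℝ) : ℝ :=
  Real.logb c (∑ i ∈ Finset.range c, p i ^ q)

/-- `τ_{μ,n}(q)`, defined by `∑_{z ∈ 𝒜₁,₂ⁿ} μ([z])^q = |w|^{-τ_{μ,n}(q)}`. -/
def tauN (c₁ c₂ : ℕ) (T : ℕ → ℕ) (a b : ℕ → ℝ) (q : ℝ) (n : ℕ) : ℝ :=
  Real.log (∑ z : Word c₁ c₂ T n, cylWeight c₁ c₂ T a b n z ^ q) /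
    Real.log ((c₁ : ℝ) ^ Ncount T n * (c₂ : ℝ) ^ (n - Ncount T n))

/-- The natural projection `γ : ∂𝒜₁,₂* → [0,1]`,
`γ(ε₁ε₂⋯) = ∑_{n≥1} εₙ c₁^{-N_n} c₂^{-(n-N_n)}`. -/
def gammaMap (c₁ c₂ : ℕ) (T : ℕ → ℕ) (x : Omg c₁ c₂ T) : ℝ :=
  ∑' n : ℕ, ((x n).val : ℝ) * Dw c₁ c₂ T (n + 1)

/-- The normalized weights `pᵢ^q / (p₁^q + ⋯ + p_c^q)`. -/
def taW (c : ℕ) (p : ℕ → ℝ) (q : ℝ) (i : ℕ) : ℝ :=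
  p i ^ q / ∑ j ∈ Finset.range c, p j ^ q

/-- `s₁ = min{max aᵢ, max bⱼ}`. -/
def sOne (c₁ c₂ : ℕ) (a b : ℕ → ℝ) : ℝ :=
  min (sSup {x | ∃ i < c₁, a i = x}) (sSup {x | ∃ j < c₂, b j = x})

/-- `s₂ = max{min aᵢ, min bⱼ}`. -/
def sTwo (c₁ c₂ : ℕ) (a b : ℕ → ℝ) : ℝ :=
  max (sInf {x | ∃ i < c₁, a i = x}) (sInf {x | ∃ j < c₂, b j = x})

/-- Entropy `h(p) = -∑_{i<2} pᵢ log₂ pᵢ`. -/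
def hEnt (p : ℕ → ℝ) : ℝ := -(∑ i ∈ Finset.range 2, p i * Real.logb 2 (p i))

/-! ### Dyadic intervals -/

/-- The family `𝓕_n` of dyadic intervals of generation `n` in `[0,1]`. -/
def Fnfam (n : ℕ) : Set (Set ℝ) :=
  {I | ∃ j : ℕ, j < 2 ^ n ∧ I = Set.Icc ((j : ℝ) / 2 ^ n) (((j : ℝ) + 1) / 2 ^ n)}

/-- Index of the dyadic interval of generation `n` containing `x`
(the left one when `x` is dyadic). -/
def dyadIdx (n : ℕ) (x : ℝ) : ℤ := ⌈x * 2 ^ n⌉ - 1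

/-- `I_n(x)`: the dyadic interval of generation `n` containing `x`
(the left one when `x` is dyadic). -/
def Idyad (n : ℕ) (x : ℝ) : Set ℝ :=
  Set.Icc ((dyadIdx n x : ℝ) / 2 ^ n) (((dyadIdx n x : ℝ) + 1) / 2 ^ n)

/-- `I_n(x)⁺`: the right neighbour of `I_n(x)` in `𝓕_n`. -/
def IdyadP (n : ℕ) (x : ℝ) : Set ℝ :=
  Set.Icc (((dyadIdx n x : ℝ) + 1) / 2 ^ n) (((dyadIdx n x : ℝ) + 2) / 2 ^ n)

/-- `I_n(x)⁻`: the left neighbour of `I_n(x)` in `𝓕_n`. -/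
def IdyadM (n : ℕ) (x : ℝ) : Set ℝ :=
  Set.Icc (((dyadIdx n x : ℝ) - 1) / 2 ^ n) ((dyadIdx n x : ℝ) / 2 ^ n)

/-! ### Mixed radix expansions -/

section Radix

variable {d : ℕ → ℕ}

/-- The length `∏_{i<n} d(i)⁻¹` of an interval of generation `n` of the mixed radix system `d`. -/
def radixScale (d : ℕ → ℕ) (n : ℕ) : ℝ := (∏ i ∈ Finset.range n, (d i : ℝ))⁻¹

/-- The sum of the first `n` terms of the mixed radix expansion with digits `x`. -/
def radixSum (x : ∀ n, Fin (d n)) (n : ℕ) : ℝ :=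
  ∑ i ∈ Finset.range n, ((x i).val : ℝ) * radixScale d (i + 1)

/-- The real number with mixed radix digits `x`. -/
def radixValue (x : ∀ n, Fin (d n)) : ℝ := ∑' n : ℕ, ((x n).val : ℝ) * radixScale d (n + 1)

/-- The digit sequences agreeing with `x` on the finite set `s` of positions. -/
def agreeOn (s : Finset ℕ) (x : ∀ n, Fin (d n)) : Set (∀ n, Fin (d n)) := {y | ∀ i ∈ s, y i = x i}

lemma radixScale_pos (hd : ∀ n, 2 ≤ d n) (n : ℕ) : 0 < radixScale d n := by
  unfold radixScale
  have : ∀ i ∈ Finset.range n, (0 : ℝ) < d i := fun i _ => by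
    have := hd i
    positivity
  exact inv_pos.2 (Finset.prod_pos this)

lemma mul_radixScale_succ (hd : ∀ n, 2 ≤ d n) (n : ℕ) :
    (d n : ℝ) * radixScale d (n + 1) = radixScale d n := by
  have : (d n : ℝ) ≠ 0 := by have := hd n; positivity
  unfold radixScale
  rw [Finset.prod_range_succ, mul_inv]
  field_simp

lemma radixScale_succ_le (hd : ∀ n, 2 ≤ d n) (n : ℕ) :
    radixScale d (n + 1) ≤ radixScale d n / 2 := by
  have h1 := mul_radixScale_succ hd n
  have h2 := radixScale_pos hd (n + 1)
  have h3 : (2 : ℝ) ≤ d n := by exact_mod_cast hd n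
  nlinarith

lemma radixScale_antitone (hd : ∀ n, 2 ≤ d n) : Antitone (radixScale d) :=
  antitone_nat_of_succ_le fun n => by
    have h1 := radixScale_succ_le hd n
    have h2 := radixScale_pos hd n
    linarith

lemma radixScale_le_pow (hd : ∀ n, 2 ≤ d n) (n : ℕ) : radixScale d n ≤ (1 / 2) ^ n := by
  induction n with
  | zero => simp [radixScale]
  | succ n ih =>
    have h1 := radixScale_succ_le hd n
    rw [pow_succ]
    linarith

lemma tendsto_radixScale (hd : ∀ n, 2 ≤ d n) : Tendsto (radixScale d) atTop (𝓝 0) :=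
  squeeze_zero (fun n => (radixScale_pos hd n).le) (radixScale_le_pow hd)
    (tendsto_pow_atTop_nhds_zero_of_lt_one (by norm_num) (by norm_num))

lemma radixScale_mul_pow_le {c : ℕ} (hd : ∀ n, 2 ≤ d n) (hc : ∀ n, d n ≤ c) (n l : ℕ) :
    radixScale d n * ((c : ℝ)⁻¹) ^ l ≤ radixScale d (n + l) := by
  have hc0 : (0 : ℝ) < c := by
    have := (hd 0).trans (hc 0)
    positivity
  induction l with
  | zero => simp
  | succ l ih =>
    have h1 := mul_radixScale_succ hd (n + l)
    have h2 := radixScale_pos hd (n + l + 1)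
    have h3 : (d (n + l) : ℝ) ≤ c := by exact_mod_cast hc _
    rw [pow_succ, ← mul_assoc, ← add_assoc]
    calc _ ≤ radixScale d (n + l) * (c : ℝ)⁻¹ := by gcongr
      _ ≤ _ := by
        rw [← div_eq_mul_inv, div_le_iff₀ hc0, ← h1, mul_comm]
        gcongr

lemma radixSum_succ (x : ∀ n, Fin (d n)) (n : ℕ) :
    radixSum x (n + 1) = radixSum x n + ((x n).val : ℝ) * radixScale d (n + 1) :=
  Finset.sum_range_succ _ _

lemma radixSum_congr {x y : ∀ n, Fin (d n)} {n : ℕ} (h : ∀ i < n, y i = x i) :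
    radixSum y n = radixSum x n :=
  Finset.sum_congr rfl fun i hi => by rw [h i (Finset.mem_range.1 hi)]

lemma radixSum_mono (hd : ∀ n, 2 ≤ d n) (x : ∀ n, Fin (d n)) : Monotone (radixSum x) :=
  monotone_nat_of_le_succ fun n => by
    rw [radixSum_succ]
    have := radixScale_pos hd (n + 1)
    have : 0 ≤ ((x n).val : ℝ) * radixScale d (n + 1) := by positivity
    linarith

lemma radixSum_add_radixScale_antitone (hd : ∀ n, 2 ≤ d n) (x : ∀ n, Fin (d n)) :
    Antitone fun n => radixSum x n + radixScale d n :=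
  antitone_nat_of_succ_le fun n => by
    have h1 := radixScale_pos hd (n + 1)
    have h2 : ((x n).val : ℝ) + 1 ≤ d n := by exact_mod_cast (x n).isLt
    have h3 := mul_radixScale_succ hd n
    rw [radixSum_succ]
    nlinarith

lemma radixSum_le_add (hd : ∀ n, 2 ≤ d n) (x : ∀ n, Fin (d n)) (m n : ℕ) :
    radixSum x m ≤ radixSum x n + radixScale d n := by
  rcases le_total m n with h | h
  · have := radixSum_mono hd x h
    have := radixScale_pos hd n
    linarith
  · have h1 : radixSum x m + radixScale d m ≤ radixSum x n + radixScale d n :=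
      radixSum_add_radixScale_antitone hd x h
    have := radixScale_pos hd m
    linarith

lemma radix_term_nonneg (hd : ∀ n, 2 ≤ d n) (x : ∀ n, Fin (d n)) (n : ℕ) :
    0 ≤ ((x n).val : ℝ) * radixScale d (n + 1) :=
  mul_nonneg (Nat.cast_nonneg _) (radixScale_pos hd _).le

lemma radixSum_le_radixValue (hd : ∀ n, 2 ≤ d n) (x : ∀ n, Fin (d n)) (n : ℕ) :
    radixSum x n ≤ radixValue x :=
  (summable_of_sum_range_le (radix_term_nonneg hd x) fun m => radixSum_le_add hd x m 0).sum_le_tsum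
    _ fun i _ => radix_term_nonneg hd x i

lemma radixValue_le (hd : ∀ n, 2 ≤ d n) (x : ∀ n, Fin (d n)) (n : ℕ) :
    radixValue x ≤ radixSum x n + radixScale d n :=
  Real.tsum_le_of_sum_range_le (radix_term_nonneg hd x) fun m => radixSum_le_add hd x m n

lemma radixValue_mem_Icc (hd : ∀ n, 2 ≤ d n) (x : ∀ n, Fin (d n)) :
    radixValue x ∈ Icc (0 : ℝ) 1 := by
  have h1 := radixSum_le_radixValue hd x 0
  have h2 := radixValue_le hd x 0
  simp only [radixSum, radixScale, Finset.range_zero, Finset.sum_empty, Finset.prod_empty,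
    inv_one, zero_add] at h1 h2
  exact ⟨h1, h2⟩

lemma dist_radixValue_le (hd : ∀ n, 2 ≤ d n) {x y : ∀ n, Fin (d n)} {n : ℕ}
    (h : y ∈ agreeOn (Finset.range n) x) : dist (radixValue y) (radixValue x) ≤ radixScale d n := by
  have h0 : radixSum y n = radixSum x n := radixSum_congr fun i hi => h i (Finset.mem_range.2 hi)
  have h1 := radixSum_le_radixValue hd x n
  have h2 := radixValue_le hd x n
  have h3 := radixSum_le_radixValue hd y n
  have h4 := radixValue_le hd y n
  rw [Real.dist_eq, abs_le]
  constructor <;> linarith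

lemma continuous_radixValue (hd : ∀ n, 2 ≤ d n) :
    Continuous (radixValue : (∀ n, Fin (d n)) → ℝ) := by
  refine continuous_tsum (u := fun n => ((1 : ℝ) / 2) ^ n) (fun n => ?_)
    (summable_geometric_of_lt_one (by norm_num) (by norm_num)) fun n x => ?_
  · have h : Continuous fun j : Fin (d n) => ((j.val : ℕ) : ℝ) := continuous_of_discreteTopology
    exact (h.comp (continuous_apply n)).mul continuous_const
  · rw [Real.norm_of_nonneg (radix_term_nonneg hd x n)]
    refine le_trans ?_ (radixScale_le_pow hd n)
    rw [← mul_radixScale_succ hd n]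
    have := radixScale_pos hd (n + 1)
    have h2 : ((x n).val : ℝ) ≤ d n := by exact_mod_cast (x n).isLt.le
    gcongr

/-- If the digits of `x` at positions `n, …, n + k - 1` are neither all minimal nor all maximal,
then every `y` whose expansion leaves that of `x` before position `n` has a value at distance at
least `radixScale d (n + k)` from that of `x`. -/
lemma radixScale_le_dist (hd : ∀ n, 2 ≤ d n) {x y : ∀ n, Fin (d n)} {n k : ℕ}
    (h0 : ∃ j ∈ Finset.Ico n (n + k), (x j).val ≠ 0)
    (h1 : ∃ j ∈ Finset.Ico n (n + k), (x j).val ≠ d j - 1)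
    (hy : y ∉ agreeOn (Finset.range n) x) :
    radixScale d (n + k) ≤ dist (radixValue y) (radixValue x) := by
  have lower : radixSum x n + radixScale d (n + k) ≤ radixValue x := by
    obtain ⟨j, hj, hx⟩ := h0
    rw [Finset.mem_Ico] at hj
    have e1 := radixSum_le_radixValue hd x (j + 1)
    have e2 := radixSum_mono hd x hj.1
    have e3 := radixScale_antitone hd (show j + 1 ≤ n + k by omega)
    have e4 : (1 : ℝ) ≤ (x j).val := by exact_mod_cast Nat.one_le_iff_ne_zero.2 hx
    have e5 := radixScale_pos hd (j + 1)
    rw [radixSum_succ] at e1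
    nlinarith
  have upper : radixValue x ≤ radixSum x n + radixScale d n - radixScale d (n + k) := by
    obtain ⟨j, hj, hx⟩ := h1
    rw [Finset.mem_Ico] at hj
    have e1 := radixValue_le hd x (j + 1)
    have e2 : radixSum x j + radixScale d j ≤ radixSum x n + radixScale d n :=
      radixSum_add_radixScale_antitone hd x hj.1
    have e3 := radixScale_antitone hd (show j + 1 ≤ n + k by omega)
    have e4 : ((x j).val : ℝ) + 2 ≤ d j := by
      have := (x j).isLt
      exact_mod_cast (show (x j).val + 2 ≤ d j by omega)
    have e5 := radixScale_pos hd (j + 1)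
    have e6 := mul_radixScale_succ hd j
    rw [radixSum_succ] at e1
    nlinarith
  have hex : ∃ i, i < n ∧ y i ≠ x i := by
    simpa [agreeOn] using hy
  classical
  obtain ⟨hj, hne⟩ := Nat.find_spec hex
  have hmin : ∀ i < Nat.find hex, y i = x i := fun i hi => by
    by_contra hcon
    exact Nat.find_min hex hi ⟨hi.trans hj, hcon⟩
  generalize Nat.find hex = j at hj hne hmin
  have hs : radixSum y j = radixSum x j := radixSum_congr hmin
  have e5 := radixScale_pos hd (j + 1)
  have hne' : (y j).val ≠ (x j).val := fun h => hne (Fin.ext h)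
  rw [Real.dist_eq, le_abs]
  rcases lt_or_gt_of_ne hne' with hlt | hlt
  · right
    have e1 := radixValue_le hd y (j + 1)
    have e2 := radixSum_mono hd x (show j + 1 ≤ n by omega)
    have e3 : ((y j).val : ℝ) + 1 ≤ (x j).val := by exact_mod_cast hlt
    rw [radixSum_succ] at e1 e2
    nlinarith
  · left
    have e1 := radixSum_le_radixValue hd y (j + 1)
    have e2 : radixSum x n + radixScale d n ≤ radixSum x (j + 1) + radixScale d (j + 1) :=
      radixSum_add_radixScale_antitone hd x (show j + 1 ≤ n by omega)
    have e3 : ((x j).val : ℝ) + 1 ≤ (y j).val := by exact_mod_cast hlt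
    rw [radixSum_succ] at e1 e2
    nlinarith

end Radix

/-! ### Product measures on digit sequences -/

section ProductMeasure

variable {d : ℕ → ℕ}

lemma exists_productMeasure (Q : ∀ n, Fin (d n) → ℝ) (hQ0 : ∀ n j, 0 ≤ Q n j)
    (hQ1 : ∀ n, ∑ j, Q n j = 1) :
    ∃ m : Measure (∀ n, Fin (d n)), IsProbabilityMeasure m ∧
      ∀ s x, m (agreeOn s x) = ENNReal.ofReal (∏ i ∈ s, Q i (x i)) := by
  have hsum : ∀ n, ∑ j, ENNReal.ofReal (Q n j) = 1 := fun n => by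
    rw [← ENNReal.ofReal_sum_of_nonneg fun j _ => hQ0 n j, hQ1, ENNReal.ofReal_one]
  let ν : ∀ n, Measure (Fin (d n)) := fun n => (PMF.ofFintype _ (hsum n)).toMeasure
  have hν : ∀ n, IsProbabilityMeasure (ν n) := fun n => PMF.toMeasure.isProbabilityMeasure _
  refine ⟨Measure.infinitePi ν, inferInstance, fun s x => ?_⟩
  have h : agreeOn s x = Set.pi s fun i => {x i} := by
    ext y
    simp [agreeOn, Set.mem_pi]
  rw [h, Measure.infinitePi_pi _ fun i _ => measurableSet_singleton _,
    ENNReal.ofReal_prod_of_nonneg fun i _ => hQ0 _ _]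
  refine Finset.prod_congr rfl fun i _ => ?_
  rw [PMF.toMeasure_apply_singleton _ _ (measurableSet_singleton _), PMF.ofFintype_apply]

lemma exists_tail_lt_one {f : ℕ → ℝ} (hf : Summable f) (n₁ : ℕ) :
    ∃ n₀, n₁ ≤ n₀ ∧ ∑' n, ENNReal.ofReal (f (n + n₀)) < 1 := by
  have h := ENNReal.tendsto_sum_nat_add (fun n => ENNReal.ofReal (f n))
    hf.tsum_ofReal_ne_top
  exact ((eventually_ge_atTop n₁).and (h.eventually_lt_const one_pos)).exists

/-- Sequences none of whose late windows of prescribed lengths is constant equal to `v` or to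
`w` have positive measure, if the window lengths grow fast enough. -/
lemma exists_windows_pos {m : Measure (∀ n, Fin (d n))} [IsProbabilityMeasure m]
    {Q : ∀ n, Fin (d n) → ℝ} (hQ0 : ∀ n j, 0 ≤ Q n j)
    (hm : ∀ s x, m (agreeOn s x) = ENNReal.ofReal (∏ i ∈ s, Q i (x i)))
    {ρ : ℝ} (hρ0 : 0 ≤ ρ) (hρ : ∀ n j, Q n j ≤ ρ) {k : ℕ → ℕ} (hk : Summable fun n => ρ ^ k n)
    (v w : ∀ n, Fin (d n)) (n₁ : ℕ) :
    ∃ n₀, n₁ ≤ n₀ ∧ 0 < m {x | ∀ n, n₀ ≤ n → (∃ j ∈ Finset.Ico n (n + k n), x j ≠ v j) ∧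
      ∃ j ∈ Finset.Ico n (n + k n), x j ≠ w j} := by
  obtain ⟨n₀, hn₀, ht⟩ := exists_tail_lt_one (hk.mul_left 2) n₁
  refine ⟨n₀, hn₀, ?_⟩
  set G := {x : ∀ n, Fin (d n) | ∀ n, n₀ ≤ n → (∃ j ∈ Finset.Ico n (n + k n), x j ≠ v j) ∧
      ∃ j ∈ Finset.Ico n (n + k n), x j ≠ w j} with hG
  have hwin : ∀ (z : ∀ n, Fin (d n)) (n : ℕ),
      m (agreeOn (Finset.Ico n (n + k n)) z) ≤ ENNReal.ofReal (ρ ^ k n) := fun z n => by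
    rw [hm]
    refine ENNReal.ofReal_le_ofReal ?_
    calc _ ≤ ∏ _i ∈ Finset.Ico n (n + k n), ρ :=
          Finset.prod_le_prod (fun i _ => hQ0 _ _) fun i _ => hρ _ _
      _ = ρ ^ k n := by simp
  have hsub : Gᶜ ⊆ ⋃ n, (agreeOn (Finset.Ico (n + n₀) (n + n₀ + k (n + n₀))) v ∪
      agreeOn (Finset.Ico (n + n₀) (n + n₀ + k (n + n₀))) w) := by
    intro x hx
    simp only [hG, mem_compl_iff, mem_ofPred_eq, not_forall] at hx
    obtain ⟨n, hn, hx⟩ := hx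
    refine mem_iUnion.2 ⟨n - n₀, ?_⟩
    rw [Nat.sub_add_cancel hn]
    by_contra hcon
    simp only [mem_union, not_or, agreeOn, mem_ofPred_eq, not_forall] at hcon
    obtain ⟨⟨i, hi, h1⟩, ⟨j, hj, h2⟩⟩ := hcon
    exact hx ⟨⟨i, hi, h1⟩, ⟨j, hj, h2⟩⟩
  have hlt : m Gᶜ < 1 := by
    refine lt_of_le_of_lt ((measure_mono hsub).trans ((measure_iUnion_le _).trans ?_)) ht
    refine ENNReal.tsum_le_tsum fun n => (measure_union_le _ _).trans ?_
    rw [two_mul, ENNReal.ofReal_add (by positivity) (by positivity)]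
    exact add_le_add (hwin _ _) (hwin _ _)
  by_contra hcon
  have h0 : m G = 0 := by simpa using hcon
  have h1 : (1 : ℝ≥0∞) ≤ m G + m Gᶜ := by
    rw [← measure_univ (μ := m), ← union_compl_self G]
    exact measure_union_le _ _
  rw [h0, zero_add] at h1
  exact absurd hlt (not_lt.2 h1)

end ProductMeasure

/-! ### Positivity of the multifractal Hausdorff measure -/

section Positivity

lemma rpow_mul_rpow_abs_le {w θ V : ℝ} (hw : 0 < w) (hθ : 0 < θ) (hV : 0 < V) (h1 : w * θ ≤ V)
    (h2 : V * θ ≤ w) (q : ℝ) : w ^ q * θ ^ |q| ≤ V ^ q := by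
  rcases le_total 0 q with hq | hq
  · rw [abs_of_nonneg hq, ← Real.mul_rpow hw.le hθ.le]
    exact Real.rpow_le_rpow (by positivity) h1 hq
  · rw [abs_of_nonpos hq]
    have h := Real.rpow_le_rpow_of_nonpos (by positivity) h2 hq
    rw [Real.mul_rpow hV.le hθ.le] at h
    calc w ^ q * θ ^ (-q) ≤ V ^ q * θ ^ q * θ ^ (-q) := by gcongr
      _ = V ^ q := by rw [mul_assoc, ← Real.rpow_add hθ]; simp

lemma rpow_abs_le_rpow {p V : ℝ} (hp : 0 < p) (h1 : p ≤ V) (h2 : V ≤ 1) (q : ℝ) :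
    p ^ |q| ≤ V ^ q := by
  have h := rpow_mul_rpow_abs_le one_pos hp (hp.trans_le h1) (by linarith)
    (by nlinarith) q
  simpa using h

lemma rpow_le_inv_rpow_abs {p V : ℝ} (hp : 0 < p) (h1 : p ≤ V) (h2 : V ≤ 1) (q : ℝ) :
    V ^ q ≤ (p ^ |q|)⁻¹ := by
  have hV : 0 < V := hp.trans_le h1
  have h := rpow_abs_le_rpow hp h1 h2 (-q)
  rw [abs_neg, Real.rpow_neg hV.le] at h
  rw [le_inv_comm₀ (by positivity) (by positivity)]
  exact h

lemma exists_windowLength {ρ β κ : ℝ} (hρ0 : 0 < ρ) (hρ1 : ρ < 1) (hβ0 : 0 < β) (hβ1 : β < 1)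
    (hκ : 0 < κ) :
    ∃ k : ℕ → ℕ, Summable (fun n => ρ ^ k n) ∧ ∀ᶠ n in atTop, β ^ n ≤ κ ^ (k (n + 1) + 1) := by
  have hσ0 : 0 < √β := Real.sqrt_pos.2 hβ0
  have hσ1 : √β < 1 := by rw [Real.sqrt_lt' one_pos]; simpa using hβ1
  obtain ⟨M, hM⟩ : ∃ M : ℕ, (√β) ^ (M + 1) ≤ κ := by
    obtain ⟨M, hM⟩ := exists_pow_lt_of_lt_one hκ hσ1
    exact ⟨M, (pow_le_pow_of_le_one hσ0.le hσ1.le M.le_succ).trans hM.le⟩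
  refine ⟨fun n => n / (M + 1), ?_, ?_⟩
  · set τ := ρ ^ ((M + 1 : ℕ) : ℝ)⁻¹ with hτ
    have hτ0 : 0 < τ := by positivity
    have hτ1 : τ < 1 := Real.rpow_lt_one hρ0.le hρ1 (by positivity)
    have hτρ : τ ^ (M + 1) = ρ := Real.rpow_inv_natCast_pow hρ0.le (by omega)
    refine Summable.of_nonneg_of_le (fun n => by positivity) (fun n => ?_)
      ((summable_geometric_of_lt_one hτ0.le hτ1).mul_left (τ ^ (M + 1))⁻¹)
    rw [inv_mul_eq_div, le_div_iff₀ (by positivity)]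
    nth_rewrite 1 [← hτρ]
    rw [← pow_mul, ← pow_add]
    refine pow_le_pow_of_le_one hτ0.le hτ1.le ?_
    have := Nat.div_add_mod n (M + 1)
    have := Nat.mod_lt n (show 0 < M + 1 by omega)
    dsimp only
    omega
  · filter_upwards [eventually_ge_atTop (M + 2)] with n hn
    calc β ^ n = (√β) ^ (2 * n) := by rw [pow_mul, Real.sq_sqrt hβ0.le]
      _ ≤ (√β) ^ ((M + 1) * ((n + 1) / (M + 1) + 1)) := by
        refine pow_le_pow_of_le_one hσ0.le hσ1.le ?_
        have := Nat.mul_div_le (n + 1) (M + 1)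
        rw [mul_add]
        omega
      _ = ((√β) ^ (M + 1)) ^ ((n + 1) / (M + 1) + 1) := pow_mul _ _ _
      _ ≤ _ := by gcongr

variable {d : ℕ → ℕ} {P : ∀ n, Fin (d n) → ℝ} {p : ℝ}

lemma prod_mul_pow_le_prod (hp0 : 0 < p) (hpP : ∀ n j, p ≤ P n j) (x : ∀ n, Fin (d n)) (n l : ℕ) :
    (∏ i ∈ Finset.range n, P i (x i)) * p ^ l ≤ ∏ i ∈ Finset.range (n + l), P i (x i) := by
  rw [Finset.prod_range_add]
  have h0 : ∀ n j, 0 < P n j := fun n j => hp0.trans_le (hpP n j)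
  gcongr
  · exact Finset.prod_nonneg fun i _ => (h0 _ _).le
  · calc p ^ l = ∏ _i ∈ Finset.range l, p := by simp
      _ ≤ _ := Finset.prod_le_prod (fun _ _ => hp0.le) fun i _ => hpP _ _

lemma weight_le_one (hp0 : 0 < p) (hpP : ∀ n j, p ≤ P n j) (hP1 : ∀ n, ∑ j, P n j = 1) (n : ℕ)
    (j : Fin (d n)) : P n j ≤ 1 := by
  rw [← hP1 n]
  exact Finset.single_le_sum (fun i _ => (hp0.trans_le (hpP n i)).le) (Finset.mem_univ j)

/-- The normalized powers `P(n,j)^q / ∑ᵢ P(n,i)^q` are bounded away from `1`. -/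
lemma normalized_rpow_le {c : ℕ} (hd : ∀ n, 2 ≤ d n) (hc : ∀ n, d n ≤ c) (hp0 : 0 < p)
    (hpP : ∀ n j, p ≤ P n j) (hP1 : ∀ n, ∑ j, P n j = 1) (q : ℝ) (n : ℕ) (j : Fin (d n)) :
    P n j ^ q / ∑ i, P n i ^ q ≤ 1 - p ^ |q| * p ^ |q| / c := by
  have hle := weight_le_one hp0 hpP hP1
  have hc0 : (0 : ℝ) < c := by
    have := (hd 0).trans (hc 0)
    positivity
  set e := p ^ |q| with he
  have he0 : 0 < e := by positivity
  have hlow : ∀ i, e ≤ P n i ^ q := fun i => rpow_abs_le_rpow hp0 (hpP n i) (hle n i) q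
  have hS : ∑ i, P n i ^ q ≤ c / e := by
    calc _ ≤ ∑ _i : Fin (d n), e⁻¹ :=
          Finset.sum_le_sum fun i _ => rpow_le_inv_rpow_abs hp0 (hpP n i) (hle n i) q
      _ = d n * e⁻¹ := by simp
      _ ≤ c * e⁻¹ := by
        have : (d n : ℝ) ≤ c := by exact_mod_cast hc n
        gcongr
      _ = c / e := (div_eq_mul_inv _ _).symm
  have : Nontrivial (Fin (d n)) := Fin.nontrivial_iff_two_le.2 (hd n)
  obtain ⟨j', hj'⟩ := exists_ne j
  have hpair : P n j ^ q + e ≤ ∑ i, P n i ^ q := by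
    calc _ ≤ P n j ^ q + P n j' ^ q := by gcongr; exact hlow j'
      _ = ∑ i ∈ {j, j'}, P n i ^ q :=
          (Finset.sum_pair (f := fun i => P n i ^ q) hj'.symm).symm
      _ ≤ _ := Finset.sum_le_sum_of_subset_of_nonneg (Finset.subset_univ _)
          fun i _ _ => he0.le.trans (hlow i)
  have hS0 : 0 < ∑ i, P n i ^ q := by
    have := he0.le.trans (hlow j)
    linarith
  have hkey : e * e / c * ∑ i, P n i ^ q ≤ e := by
    calc _ ≤ e * e / c * (c / e) := by gcongr
      _ = e := by field_simp
  rw [div_le_iff₀ hS0]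
  linarith

/-- A sequence tending to `0` that starts above `r > 0` at `n₀` crosses `r` in one step at some
later time. -/
lemma exists_crossing {u : ℕ → ℝ} (hu : Tendsto u atTop (𝓝 0)) {r : ℝ} (hr : 0 < r) {n₀ : ℕ}
    (h : r < u n₀) : ∃ n, n₀ ≤ n ∧ r < u n ∧ u (n + 1) ≤ r := by
  by_contra! hcon
  have hall : ∀ n, n₀ ≤ n → r < u n := fun n hn =>
    Nat.le_induction h (fun n hn ih => hcon n hn ih) n hn
  obtain ⟨n, hn, hlt⟩ := ((eventually_ge_atTop n₀).and (hu.eventually_lt_const hr)).exists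
  exact absurd (hall n hn) (not_lt.2 hlt.le)

theorem exists_Hpre_pos {c : ℕ} (hd : ∀ n, 2 ≤ d n) (hc : ∀ n, d n ≤ c) (hp0 : 0 < p)
    (hpP : ∀ n j, p ≤ P n j) (hP1 : ∀ n, ∑ j, P n j = 1)
    {m : Measure (∀ n, Fin (d n))} [IsProbabilityMeasure m]
    (hm : ∀ n x, m (agreeOn (Finset.range n) x) =
      ENNReal.ofReal (∏ i ∈ Finset.range n, P i (x i)))
    {q t ε : ℝ} (hε : 0 < ε)
    (hS : ∀ᶠ n in atTop, (∏ i ∈ Finset.range n, ∑ j, P i j ^ q)⁻¹ ≤ radixScale d n ^ (t + ε)) :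
    ∃ G : Set (∀ n, Fin (d n)), 0 < Hpre (m.map radixValue) q t (radixValue '' G) := by
  have hP0 : ∀ n j, 0 < P n j := fun n j => hp0.trans_le (hpP n j)
  have hle := weight_le_one hp0 hpP hP1
  have hp1 : p ≤ 1 := (hpP 0 ⟨0, by have := hd 0; omega⟩).trans (hle _ _)
  have hc2 : (2 : ℝ) ≤ c := by exact_mod_cast (hd 0).trans (hc 0)
  set S : ℕ → ℝ := fun n => ∑ j, P n j ^ q with hSdef
  have hS0 : ∀ n, 0 < S n := fun n => Finset.sum_pos (fun j _ => Real.rpow_pos_of_pos (hP0 n j) q)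
    ⟨⟨0, by have := hd n; omega⟩, Finset.mem_univ _⟩
  set Q : ∀ n, Fin (d n) → ℝ := fun n j => P n j ^ q / S n with hQdef
  have hQ0 : ∀ n j, 0 ≤ Q n j := fun n j =>
    div_nonneg (Real.rpow_nonneg (hP0 n j).le q) (hS0 n).le
  have hQ1 : ∀ n, ∑ j, Q n j = 1 := fun n => by
    rw [← Finset.sum_div]
    exact div_self (hS0 n).ne'
  obtain ⟨m', hm'prob, hm'⟩ := exists_productMeasure Q hQ0 hQ1
  set ρ : ℝ := 1 - p ^ |q| * p ^ |q| / c with hρdef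
  have hpq0 : 0 < p ^ |q| := by positivity
  have hpq1 : p ^ |q| ≤ 1 := Real.rpow_le_one hp0.le hp1 (abs_nonneg q)
  have hρ1 : ρ < 1 := by
    have : 0 < p ^ |q| * p ^ |q| / c := by positivity
    linarith
  have hρ0 : 0 < ρ := by
    have : p ^ |q| * p ^ |q| / c < 1 := by
      rw [div_lt_one (by positivity)]
      nlinarith
    linarith
  set κ : ℝ := p ^ |q| * ((c : ℝ)⁻¹) ^ |t| with hκdef
  have hκ0 : 0 < κ := by positivity
  obtain ⟨k, hksum, hk⟩ := exists_windowLength hρ0 hρ1 (β := (1 / 2) ^ ε) (by positivity)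
    (Real.rpow_lt_one (by norm_num) (by norm_num) hε) hκ0
  obtain ⟨n₁, hn₁⟩ := eventually_atTop.1 (hS.and hk)
  obtain ⟨n₀, hn₀, hG0⟩ := exists_windows_pos hQ0 hm' hρ0.le
    (normalized_rpow_le hd hc hp0 hpP hP1 q) hksum
    (fun n => ⟨0, by have := hd n; omega⟩) (fun n => ⟨d n - 1, by have := hd n; omega⟩) n₁
  set G := {x : ∀ n, Fin (d n) | ∀ n, n₀ ≤ n →
    (∃ j ∈ Finset.Ico n (n + k n), x j ≠ ⟨0, by have := hd j; omega⟩) ∧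
      ∃ j ∈ Finset.Ico n (n + k n), x j ≠ ⟨d j - 1, by have := hd j; omega⟩} with hG
  have hmeas : Measurable (radixValue : (∀ n, Fin (d n)) → ℝ) :=
    (continuous_radixValue hd).measurable
  have hmapprob : IsProbabilityMeasure (m.map radixValue) :=
    Measure.isProbabilityMeasure_map hmeas.aemeasurable
  set δ := radixScale d (n₀ + k n₀) / 2 with hδ
  have hδ0 : 0 < δ := half_pos (radixScale_pos hd _)
  have key : ∀ x ∈ G, ∀ r, 0 < r → r ≤ δ →
      m' (radixValue ⁻¹' closedBall (radixValue x) r) ≤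
        (m.map radixValue) (closedBall (radixValue x) r) ^ q * ENNReal.ofReal (2 * r) ^ t := by
    intro x hx r hr hrδ
    have hlim : Tendsto (fun n => radixScale d (n + k n)) atTop (𝓝 0) :=
      (tendsto_radixScale hd).comp (tendsto_atTop_mono (fun n => Nat.le_add_right n (k n)) tendsto_id)
    obtain ⟨n, hn, hr1, hr2⟩ := exists_crossing hlim hr (n₀ := n₀)
      (by have := radixScale_pos hd (n₀ + k n₀); linarith)
    obtain ⟨hSn, hkn⟩ := hn₁ n (hn₀.trans hn)
    obtain ⟨hx0, hx1⟩ := hx n hn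
    have hin : radixValue ⁻¹' closedBall (radixValue x) r ⊆ agreeOn (Finset.range n) x := by
      intro y hy
      by_contra hcon
      have h := radixScale_le_dist hd
        (hx0.imp fun j hj => ⟨hj.1, fun h => hj.2 (Fin.ext h)⟩)
        (hx1.imp fun j hj => ⟨hj.1, fun h => hj.2 (Fin.ext h)⟩) hcon
      have h' : dist (radixValue y) (radixValue x) ≤ r := hy
      linarith
    set l := k (n + 1) + 1 with hl
    have hnl : n + 1 + k (n + 1) = n + l := by omega
    rw [hnl] at hr2
    have hout : agreeOn (Finset.range (n + l)) x ⊆ radixValue ⁻¹' closedBall (radixValue x) r :=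
      fun y hy => (dist_radixValue_le hd hy).trans hr2
    set D := radixScale d n with hD
    have hD0 : 0 < D := radixScale_pos hd n
    set W := ∏ i ∈ Finset.range n, P i (x i) with hW
    have hW0 : 0 < W := Finset.prod_pos fun i _ => hP0 _ _
    have hball : (m.map radixValue) (closedBall (radixValue x) r) =
        m (radixValue ⁻¹' closedBall (radixValue x) r) :=
      Measure.map_apply hmeas measurableSet_closedBall
    set V := ((m.map radixValue) (closedBall (radixValue x) r)).toReal with hV
    have hVeq : (m.map radixValue) (closedBall (radixValue x) r) = ENNReal.ofReal V :=
      (ENNReal.ofReal_toReal (measure_ne_top _ _)).symm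
    have hVle : V ≤ W := by
      have h := measure_mono (μ := m) hin
      rw [← hball, hm, hVeq] at h
      exact (ENNReal.ofReal_le_ofReal_iff hW0.le).1 h
    have hleV : W * p ^ l ≤ V := by
      refine (prod_mul_pow_le_prod hp0 hpP x n l).trans ?_
      have h := measure_mono (μ := m) hout
      rw [← hball, hm, hVeq] at h
      exact (ENNReal.ofReal_le_ofReal_iff ENNReal.toReal_nonneg).1 h
    have hV0 : 0 < V := lt_of_lt_of_le (by positivity) hleV
    have e1 : W ^ q * (p ^ l) ^ |q| ≤ V ^ q := by
      refine rpow_mul_rpow_abs_le hW0 (by positivity) hV0 hleV ?_ q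
      calc V * p ^ l ≤ V * 1 := by
            gcongr
            exact pow_le_one₀ hp0.le hp1
        _ ≤ W := by linarith
    have e2 : D ^ t * (((c : ℝ)⁻¹) ^ l) ^ |t| ≤ (2 * r) ^ t := by
      have hlow := radixScale_mul_pow_le hd hc n l
      have hup : r ≤ D := hr1.le.trans (radixScale_antitone hd (Nat.le_add_right n (k n)))
      refine rpow_mul_rpow_abs_le hD0 (by positivity) (by positivity) (by linarith) ?_ t
      have hcl : ((c : ℝ)⁻¹) ^ l ≤ 1 / 2 := by
        calc _ ≤ ((c : ℝ)⁻¹) ^ 1 :=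
              pow_le_pow_of_le_one (by positivity) (inv_le_one_of_one_le₀ (by linarith)) (by omega)
          _ ≤ 1 / 2 := by
            rw [pow_one, one_div]
            gcongr
      nlinarith
    have e3 : κ ^ l = (p ^ l) ^ |q| * (((c : ℝ)⁻¹) ^ l) ^ |t| := by
      rw [hκdef, mul_pow, Real.rpow_pow_comm hp0.le, Real.rpow_pow_comm (by positivity)]
    have e4 : D ^ ε ≤ κ ^ l := by
      refine le_trans ?_ hkn
      rw [Real.rpow_pow_comm (by norm_num)]
      exact Real.rpow_le_rpow hD0.le (radixScale_le_pow hd n) hε.le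
    have e5 : ∏ i ∈ Finset.range n, Q i (x i) = W ^ q * (∏ i ∈ Finset.range n, S i)⁻¹ := by
      rw [hQdef, Finset.prod_div_distrib, div_eq_mul_inv,
        Real.finsetProd_rpow _ _ fun i _ => (hP0 _ _).le]
    calc m' (radixValue ⁻¹' closedBall (radixValue x) r) ≤ m' (agreeOn (Finset.range n) x) :=
          measure_mono hin
      _ = ENNReal.ofReal (W ^ q * (∏ i ∈ Finset.range n, S i)⁻¹) := by rw [hm', e5]
      _ ≤ ENNReal.ofReal (V ^ q * (2 * r) ^ t) := by
        refine ENNReal.ofReal_le_ofReal ?_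
        calc _ ≤ W ^ q * (D ^ t * κ ^ l) := by
              gcongr
              refine hSn.trans ?_
              rw [Real.rpow_add hD0]
              gcongr
          _ = (W ^ q * (p ^ l) ^ |q|) * (D ^ t * (((c : ℝ)⁻¹) ^ l) ^ |t|) := by
            rw [e3]
            ring
          _ ≤ _ := by gcongr
      _ = _ := by
        rw [ENNReal.ofReal_mul (by positivity), hVeq, ENNReal.ofReal_rpow_of_pos hV0,
          ENNReal.ofReal_rpow_of_pos (by positivity)]
  refine ⟨G, hG0.trans_le ?_⟩
  refine le_trans ?_ (le_iSup₂ (f := fun δ (_ : 0 < δ) =>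
    Hdel (m.map radixValue) q t δ (radixValue '' G)) δ hδ0)
  refine le_iInf fun ι => le_iInf fun _ => le_iInf fun z => le_iInf fun r => le_iInf fun hz =>
    le_iInf fun hr => le_iInf fun hcov => ?_
  calc m' G ≤ m' (⋃ i, radixValue ⁻¹' closedBall (z i) (r i)) := by
        refine measure_mono fun x hx => ?_
        simpa using hcov (mem_image_of_mem _ hx)
    _ ≤ ∑' i, m' (radixValue ⁻¹' closedBall (z i) (r i)) := measure_iUnion_le _
    _ ≤ _ := ENNReal.tsum_le_tsum fun i => by
        obtain ⟨x, hx, hxz⟩ := hz i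
        rw [← hxz]
        exact key x hx _ (hr i).1 (hr i).2

end Positivity

/-! ### Support and finiteness -/

section Support

variable {d : ℕ → ℕ} {P : ∀ n, Fin (d n) → ℝ} {p : ℝ}

lemma msupport_map_radixValue (hd : ∀ n, 2 ≤ d n) {m : Measure (∀ n, Fin (d n))}
    (hm : ∀ n x, 0 < m (agreeOn (Finset.range n) x)) :
    msupport (m.map radixValue) = range (radixValue : (∀ n, Fin (d n)) → ℝ) := by
  have hcont := continuous_radixValue hd
  have hmap : ∀ x r, (m.map radixValue) (ball x r) = m (radixValue ⁻¹' ball x r) := fun x r =>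
    Measure.map_apply hcont.measurable measurableSet_ball
  refine Subset.antisymm (fun x hx => ?_) ?_
  · by_contra hcon
    have hopen : IsOpen (range (radixValue : (∀ n, Fin (d n)) → ℝ))ᶜ :=
      (isCompact_range hcont).isClosed.isOpen_compl
    obtain ⟨r, hr, hsub⟩ := Metric.isOpen_iff.1 hopen x hcon
    have h := hx r hr
    have hempty : (radixValue : (∀ n, Fin (d n)) → ℝ) ⁻¹' ball x r = ∅ :=
      eq_empty_of_forall_notMem fun y hy => hsub hy (mem_range_self y)
    rw [hmap, hempty, measure_empty] at h
    exact lt_irrefl _ h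
  · rintro _ ⟨x, rfl⟩ r hr
    obtain ⟨n, hn⟩ := ((tendsto_radixScale hd).eventually_lt_const hr).exists
    rw [hmap]
    exact (hm n x).trans_le (measure_mono fun y hy => (dist_radixValue_le hd hy).trans_lt hn)

lemma Hdel_map_radixValue_le {c : ℕ} (hd : ∀ n, 2 ≤ d n) (hc : ∀ n, d n ≤ c) (hp0 : 0 < p)
    (hpP : ∀ n j, p ≤ P n j) {m : Measure (∀ n, Fin (d n))} [IsProbabilityMeasure m]
    (hm : ∀ n x, m (agreeOn (Finset.range n) x) =
      ENNReal.ofReal (∏ i ∈ Finset.range n, P i (x i)))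
    (q : ℝ) (N n : ℕ) {δ : ℝ} (hδ : radixScale d n ≤ δ) {F : Set ℝ}
    (hF : F ⊆ range (radixValue : (∀ n, Fin (d n)) → ℝ)) :
    Hdel (m.map radixValue) q N δ F ≤
      ENNReal.ofReal (2 ^ N * (c * (p ^ |q|)⁻¹ * (1 / 2) ^ N) ^ n) := by
  have hmeas : Measurable (radixValue : (∀ n, Fin (d n)) → ℝ) :=
    (continuous_radixValue hd).measurable
  have hmapprob : IsProbabilityMeasure (m.map radixValue) :=
    Measure.isProbabilityMeasure_map hmeas.aemeasurable
  let ι := {z : ∀ i : Fin n, Fin (d i) // ∃ x : ∀ n, Fin (d n), radixValue x ∈ F ∧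
    ∀ i : Fin n, x i = z i}
  choose x hxF hxz using fun z : ι => z.2
  have hu0 := radixScale_pos hd n
  have hcov : F ⊆ ⋃ z, closedBall (radixValue (x z)) (radixScale d n) := fun v hv => by
    obtain ⟨y, rfl⟩ := hF hv
    let z : ι := ⟨fun i => y i, y, hv, fun i => rfl⟩
    refine mem_iUnion.2 ⟨z, dist_radixValue_le hd fun i hi => ?_⟩
    exact (hxz z ⟨i, Finset.mem_range.1 hi⟩).symm
  have hterm : ∀ y : ∀ n, Fin (d n),
      (m.map radixValue) (closedBall (radixValue y) (radixScale d n)) ^ q *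
        ENNReal.ofReal (2 * radixScale d n) ^ (N : ℝ) ≤
      ENNReal.ofReal (((p ^ n) ^ |q|)⁻¹ * (2 * (1 / 2) ^ n) ^ N) := fun y => by
    set V := ((m.map radixValue) (closedBall (radixValue y) (radixScale d n))).toReal with hV
    have hVeq : (m.map radixValue) (closedBall (radixValue y) (radixScale d n)) =
        ENNReal.ofReal V := (ENNReal.ofReal_toReal (measure_ne_top _ _)).symm
    have hV1 : V ≤ 1 := ENNReal.toReal_le_of_le_ofReal one_pos.le (by simpa using prob_le_one)
    have hleV : p ^ n ≤ V := by
      have h := measure_mono (μ := m) (show agreeOn (Finset.range n) y ⊆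
        radixValue ⁻¹' closedBall (radixValue y) (radixScale d n) from
          fun _ hy => dist_radixValue_le hd hy)
      rw [← Measure.map_apply hmeas measurableSet_closedBall, hm, hVeq,
        ENNReal.ofReal_le_ofReal_iff ENNReal.toReal_nonneg] at h
      simpa using (prod_mul_pow_le_prod hp0 hpP y 0 n).trans (by simpa using h)
    have hV0 : 0 < V := lt_of_lt_of_le (by positivity) hleV
    rw [hVeq, ENNReal.ofReal_rpow_of_pos hV0, ENNReal.rpow_natCast,
      ← ENNReal.ofReal_pow (by positivity), ← ENNReal.ofReal_mul (by positivity)]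
    refine ENNReal.ofReal_le_ofReal ?_
    gcongr
    · exact rpow_le_inv_rpow_abs (by positivity) hleV hV1 q
    · exact radixScale_le_pow hd n
  have hcard : (Fintype.card ι : ℝ) ≤ c ^ n := by
    have h1 : Fintype.card ι ≤ c ^ n := by
      calc Fintype.card ι ≤ Fintype.card (∀ i : Fin n, Fin (d i)) := Fintype.card_subtype_le _
        _ = ∏ i : Fin n, d i := by simp
        _ ≤ ∏ _i : Fin n, c := Finset.prod_le_prod' fun i _ => hc i
        _ = c ^ n := by simp
    exact_mod_cast h1
  calc Hdel (m.map radixValue) q N δ F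
      ≤ olsenSum (m.map radixValue) q N (fun z => radixValue (x z)) fun _ => radixScale d n :=
        iInf_le_of_le ι <| iInf_le_of_le inferInstance <| iInf_le_of_le _ <| iInf_le_of_le _ <|
          iInf_le_of_le hxF <| iInf_le_of_le (fun _ => ⟨hu0, hδ⟩) <| iInf_le _ hcov
    _ ≤ ∑' _z : ι, ENNReal.ofReal (((p ^ n) ^ |q|)⁻¹ * (2 * (1 / 2) ^ n) ^ N) :=
        ENNReal.tsum_le_tsum fun z => hterm (x z)
    _ = ENNReal.ofReal (Fintype.card ι * (((p ^ n) ^ |q|)⁻¹ * (2 * (1 / 2) ^ n) ^ N)) := by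
        rw [tsum_fintype, Finset.sum_const, Finset.card_univ, nsmul_eq_mul,
          ENNReal.ofReal_mul (Nat.cast_nonneg _), ENNReal.ofReal_natCast]
    _ ≤ _ := by
        refine ENNReal.ofReal_le_ofReal ?_
        calc _ ≤ (c : ℝ) ^ n * (((p ^ n) ^ |q|)⁻¹ * (2 * (1 / 2) ^ n) ^ N) := by gcongr
          _ = _ := by
            rw [← Real.rpow_pow_comm hp0.le, mul_pow, mul_pow, mul_pow, inv_pow,
              pow_right_comm (1 / 2 : ℝ) n N]
            ring

lemma exists_Hmeas_eq_zero {c : ℕ} (hd : ∀ n, 2 ≤ d n) (hc : ∀ n, d n ≤ c) (hp0 : 0 < p)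
    (hpP : ∀ n j, p ≤ P n j) {m : Measure (∀ n, Fin (d n))} [IsProbabilityMeasure m]
    (hm : ∀ n x, m (agreeOn (Finset.range n) x) =
      ENNReal.ofReal (∏ i ∈ Finset.range n, P i (x i))) (q : ℝ) :
    ∃ t, Hmeas (m.map radixValue) q t (range (radixValue : (∀ n, Fin (d n)) → ℝ)) = 0 := by
  have hc0 : (0 : ℝ) < c := by
    have := (hd 0).trans (hc 0)
    positivity
  have hA : 0 < (c : ℝ) * (p ^ |q|)⁻¹ := by positivity
  obtain ⟨N, hN⟩ := exists_pow_lt_of_lt_one (inv_pos.2 hA) (show (1 / 2 : ℝ) < 1 by norm_num)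
  set θ := (c : ℝ) * (p ^ |q|)⁻¹ * (1 / 2) ^ N with hθ
  have hθ0 : 0 ≤ θ := by positivity
  have hθ1 : θ < 1 := by
    calc θ < c * (p ^ |q|)⁻¹ * ((c : ℝ) * (p ^ |q|)⁻¹)⁻¹ := mul_lt_mul_of_pos_left hN hA
      _ = 1 := mul_inv_cancel₀ hA.ne'
  refine ⟨N, ?_⟩
  simp only [Hmeas, Hpre, ENNReal.iSup_eq_zero]
  intro F hF δ hδ
  have hlim : Tendsto (fun n => ENNReal.ofReal (2 ^ N * θ ^ n)) atTop (𝓝 0) := by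
    have h := (tendsto_pow_atTop_nhds_zero_of_lt_one hθ0 hθ1).const_mul ((2 : ℝ) ^ N)
    rw [mul_zero] at h
    simpa using ENNReal.tendsto_ofReal h
  refine le_antisymm (ge_of_tendsto hlim ?_) zero_le
  filter_upwards [(tendsto_radixScale hd).eventually_lt_const hδ] with n hn
  exact Hdel_map_radixValue_le hd hc hp0 hpP hm q N n hn.le hF

lemma Hpre_le_Hmeas {X : Type} [MetricSpace X] [MeasurableSpace X] (m : Measure X) (q t : ℝ)
    {E F : Set X} (h : E ⊆ F) : Hpre m q t E ≤ Hmeas m q t F :=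
  le_iSup₂ (f := fun G (_ : G ⊆ F) => Hpre m q t G) E h

end Support

/-! ### Mixed alphabets -/

section Mixed

variable {c₁ c₂ : ℕ} {T : ℕ → ℕ}

/-- The weights of the inhomogeneous multinomial measure. -/
def mixedWeight (c₁ c₂ : ℕ) (T : ℕ → ℕ) (a b : ℕ → ℝ) (n : ℕ) (j : Fin (Yc c₁ c₂ T n)) : ℝ :=
  if isA T (n + 1) then a j.val else b j.val

lemma two_le_Yc (hc₁ : 2 ≤ c₁) (hc₂ : 2 ≤ c₂) (n : ℕ) : 2 ≤ Yc c₁ c₂ T n := by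
  unfold Yc
  split_ifs <;> assumption

lemma Yc_le_max (n : ℕ) : Yc c₁ c₂ T n ≤ max c₁ c₂ := by
  unfold Yc
  split_ifs
  · exact le_max_left _ _
  · exact le_max_right _ _

lemma Ncount_succ (n : ℕ) : Ncount T (n + 1) = Ncount T n + if isA T (n + 1) then 1 else 0 := by
  unfold Ncount
  rw [← Finset.insert_Icc_right_eq_Icc_add_one (by omega), Finset.filter_insert]
  split_ifs
  · rw [Finset.card_insert_of_notMem (by simp)]
  · rfl

lemma Ncount_le (n : ℕ) : Ncount T n ≤ n :=
  (Finset.card_filter_le _ _).trans (by simp)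

lemma pow_Ncount_mul_pow (n : ℕ) :
    (c₁ : ℝ) ^ Ncount T n * (c₂ : ℝ) ^ (n - Ncount T n) =
      ∏ i ∈ Finset.range n, (Yc c₁ c₂ T i : ℝ) := by
  induction n with
  | zero => simp [Ncount]
  | succ n ih =>
    rw [Finset.prod_range_succ, ← ih, Ncount_succ]
    have h := Ncount_le (T := T) n
    unfold Yc
    split_ifs
    · rw [Nat.add_sub_add_right, pow_succ]
      ring
    · rw [add_zero, Nat.sub_add_comm h, pow_succ]
      ring

lemma Dw_eq_radixScale (n : ℕ) : Dw c₁ c₂ T n = radixScale (Yc c₁ c₂ T) n := by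
  rw [Dw, pow_Ncount_mul_pow, radixScale]

lemma gammaMap_eq_radixValue : gammaMap c₁ c₂ T = radixValue := by
  funext x
  simp only [gammaMap, radixValue, Dw_eq_radixScale]

lemma sum_mixedWeight {a b : ℕ → ℝ} (hsa : ∑ i ∈ Finset.range c₁, a i = 1)
    (hsb : ∑ j ∈ Finset.range c₂, b j = 1) (n : ℕ) : ∑ j, mixedWeight c₁ c₂ T a b n j = 1 := by
  unfold mixedWeight
  rw [Fin.sum_univ_eq_sum_range (fun j => if isA T (n + 1) then a j else b j)]
  unfold Yc
  split_ifs <;> assumption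

lemma exists_pos_le {c : ℕ} {a : ℕ → ℝ} (ha : ∀ i, i < c → 0 < a i) :
    ∃ p, 0 < p ∧ ∀ i, i < c → p ≤ a i := by
  rcases (Finset.range c).eq_empty_or_nonempty with h | h
  · refine ⟨1, one_pos, fun i hi => ?_⟩
    rw [Finset.range_eq_empty_iff] at h
    omega
  · obtain ⟨i, hi, hmin⟩ := Finset.exists_min_image _ a h
    exact ⟨a i, ha i (Finset.mem_range.1 hi), fun j hj => hmin j (Finset.mem_range.2 hj)⟩

lemma exists_pos_le_mixedWeight {a b : ℕ → ℝ} (ha : ∀ i, i < c₁ → 0 < a i)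
    (hb : ∀ j, j < c₂ → 0 < b j) : ∃ p, 0 < p ∧ ∀ n j, p ≤ mixedWeight c₁ c₂ T a b n j := by
  obtain ⟨p₁, hp₁, h₁⟩ := exists_pos_le ha
  obtain ⟨p₂, hp₂, h₂⟩ := exists_pos_le hb
  refine ⟨min p₁ p₂, lt_min hp₁ hp₂, fun n j => ?_⟩
  have hj := j.isLt
  unfold mixedWeight
  by_cases h : isA T (n + 1)
  · rw [if_pos h]
    exact (min_le_left _ _).trans (h₁ _ (by simpa [Yc, h] using hj))
  · rw [if_neg h]
    exact (min_le_right _ _).trans (h₂ _ (by simpa [Yc, h] using hj))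

lemma tauN_eq {a b : ℕ → ℝ} (h0 : ∀ n j, 0 ≤ mixedWeight c₁ c₂ T a b n j) (q : ℝ) (n : ℕ) :
    tauN c₁ c₂ T a b q n =
      Real.log (∏ i ∈ Finset.range n, ∑ j, mixedWeight c₁ c₂ T a b i j ^ q) /
        -Real.log (radixScale (Yc c₁ c₂ T) n) := by
  unfold tauN
  rw [pow_Ncount_mul_pow, radixScale, Real.log_inv, neg_neg]
  congr 2
  rw [← Fin.prod_univ_eq_prod_range (fun i => ∑ j, mixedWeight c₁ c₂ T a b i j ^ q),
    Finset.prod_univ_sum, Fintype.piFinset_univ]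
  refine Finset.sum_congr rfl fun z _ => ?_
  exact (Real.finsetProd_rpow _ (fun i : Fin n => mixedWeight c₁ c₂ T a b i (z i))
    (fun i _ => h0 i (z i)) q).symm

lemma mul_log_two_le_neg_log_radixScale {d : ℕ → ℕ} (hd : ∀ n, 2 ≤ d n) (n : ℕ) :
    n * Real.log 2 ≤ -Real.log (radixScale d n) := by
  have h := Real.log_le_log (radixScale_pos hd n) (radixScale_le_pow hd n)
  rw [Real.log_pow, one_div, Real.log_inv] at h
  linarith

/-- The sums `∑ⱼ P(n,j)^q` are bounded below. -/
lemma rpow_abs_le_sum_rpow {d : ℕ → ℕ} {P : ∀ n, Fin (d n) → ℝ} {p : ℝ} (hd : ∀ n, 2 ≤ d n)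
    (hp0 : 0 < p) (hpP : ∀ n j, p ≤ P n j) (hP1 : ∀ n, ∑ j, P n j = 1) (q : ℝ) (n : ℕ) :
    p ^ |q| ≤ ∑ j, P n j ^ q := by
  have h0 : ∀ n j, 0 < P n j := fun n j => hp0.trans_le (hpP n j)
  let j₀ : Fin (d n) := ⟨0, by have := hd n; omega⟩
  exact (rpow_abs_le_rpow hp0 (hpP n j₀) (weight_le_one hp0 hpP hP1 n j₀) q).trans
    (Finset.single_le_sum (f := fun j => P n j ^ q)
      (fun j _ => Real.rpow_nonneg (h0 n j).le q) (Finset.mem_univ j₀))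

lemma isBoundedUnder_tauN {a b : ℕ → ℝ} {p : ℝ} (hc₁ : 2 ≤ c₁) (hc₂ : 2 ≤ c₂) (hp0 : 0 < p)
    (hpP : ∀ n j, p ≤ mixedWeight c₁ c₂ T a b n j)
    (hP1 : ∀ n, ∑ j, mixedWeight c₁ c₂ T a b n j = 1) (q : ℝ) :
    IsBoundedUnder (· ≥ ·) atTop (tauN c₁ c₂ T a b q) := by
  have hd := two_le_Yc (T := T) hc₁ hc₂
  have hP0 : ∀ n j, 0 ≤ mixedWeight c₁ c₂ T a b n j := fun n j => hp0.le.trans (hpP n j)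
  refine isBoundedUnder_of ⟨Real.log (p ^ |q|) / Real.log 2, fun n => ?_⟩
  rw [ge_iff_le, tauN_eq hP0]
  have hlog2 : 0 < Real.log 2 := Real.log_pos (by norm_num)
  have hp1 : p ≤ 1 := (hpP 0 ⟨0, by have := hd 0; omega⟩).trans
    (weight_le_one hp0 hpP hP1 _ _)
  have he0 : 0 < p ^ |q| := by positivity
  have he : Real.log (p ^ |q|) ≤ 0 :=
    Real.log_nonpos he0.le (Real.rpow_le_one hp0.le hp1 (abs_nonneg q))
  have hB : Real.log (p ^ |q|) / Real.log 2 ≤ 0 := div_nonpos_of_nonpos_of_nonneg he hlog2.le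
  have hden := mul_log_two_le_neg_log_radixScale hd n
  have hnum : n * Real.log (p ^ |q|) ≤
      Real.log (∏ i ∈ Finset.range n, ∑ j, mixedWeight c₁ c₂ T a b i j ^ q) := by
    rw [← Real.log_pow]
    refine Real.log_le_log (by positivity) ?_
    calc (p ^ |q|) ^ n = ∏ _i ∈ Finset.range n, p ^ |q| := by simp
      _ ≤ _ := Finset.prod_le_prod (fun _ _ => he0.le) fun i _ =>
        rpow_abs_le_sum_rpow hd hp0 hpP hP1 q i
  have hden0 : 0 ≤ -Real.log (radixScale (Yc c₁ c₂ T) n) := le_trans (by positivity) hden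
  rcases hden0.eq_or_lt with h | h
  · rw [← h, div_zero]
    exact hB
  · rw [le_div_iff₀ h]
    refine le_trans ?_ hnum
    calc _ ≤ Real.log (p ^ |q|) / Real.log 2 * (n * Real.log 2) :=
          mul_le_mul_of_nonpos_left hden hB
      _ = _ := by field_simp

lemma eventually_inv_prod_le {a b : ℕ → ℝ} {p : ℝ} (hc₁ : 2 ≤ c₁) (hc₂ : 2 ≤ c₂) (hp0 : 0 < p)
    (hpP : ∀ n j, p ≤ mixedWeight c₁ c₂ T a b n j)
    (hP1 : ∀ n, ∑ j, mixedWeight c₁ c₂ T a b n j = 1) {q s : ℝ}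
    (hs : s < liminf (tauN c₁ c₂ T a b q) atTop) :
    ∀ᶠ n in atTop, (∏ i ∈ Finset.range n, ∑ j, mixedWeight c₁ c₂ T a b i j ^ q)⁻¹ ≤
      radixScale (Yc c₁ c₂ T) n ^ s := by
  have hd := two_le_Yc (T := T) hc₁ hc₂
  have hP0 : ∀ n j, 0 ≤ mixedWeight c₁ c₂ T a b n j := fun n j => hp0.le.trans (hpP n j)
  filter_upwards [eventually_lt_of_lt_liminf hs (isBoundedUnder_tauN hc₁ hc₂ hp0 hpP hP1 q),
    eventually_ge_atTop 1] with n hn hn1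
  have hden0 : 0 < -Real.log (radixScale (Yc c₁ c₂ T) n) :=
    lt_of_lt_of_le (mul_pos (by positivity) (Real.log_pos (by norm_num)))
      (mul_log_two_le_neg_log_radixScale hd n)
  have hprod : 0 < ∏ i ∈ Finset.range n, ∑ j, mixedWeight c₁ c₂ T a b i j ^ q :=
    Finset.prod_pos fun i _ => lt_of_lt_of_le (by positivity)
      (rpow_abs_le_sum_rpow hd hp0 hpP hP1 q i)
  rw [tauN_eq hP0, lt_div_iff₀ hden0] at hn
  rw [Real.rpow_def_of_pos (radixScale_pos hd n), ← Real.exp_log hprod, ← Real.exp_neg]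
  refine Real.exp_le_exp.2 ?_
  linarith

lemma measure_agreeOn_range {a b : ℕ → ℝ} {μ : Measure (Omg c₁ c₂ T)}
    (hμ : ∀ (n : ℕ) (w : Word c₁ c₂ T n),
      μ (cyl c₁ c₂ T n w) = ENNReal.ofReal (cylWeight c₁ c₂ T a b n w))
    (n : ℕ) (x : Omg c₁ c₂ T) : μ (agreeOn (Finset.range n) x) =
      ENNReal.ofReal (∏ i ∈ Finset.range n, mixedWeight c₁ c₂ T a b i (x i)) := by
  have h : agreeOn (Finset.range n) x = cyl c₁ c₂ T n fun i => x i := by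
    ext y
    simp only [agreeOn, cyl, mem_ofPred_eq, Finset.mem_range]
    exact ⟨fun h i => h i i.isLt, fun h i hi => h ⟨i, hi⟩⟩
  rw [h, hμ, ← Fin.prod_univ_eq_prod_range (fun i => mixedWeight c₁ c₂ T a b i (x i))]
  rfl

end Mixed

/-- `𝓗^{q, τ̲_μ(q)-ε}_ν([0,1]) > 0`, hence `b_ν(q) ≥ τ̲_μ(q)`. -/
theorem stmt9 (c₁ c₂ : ℕ) (hc₁ : 2 ≤ c₁) (hc₂ : 2 ≤ c₂)
    (T : ℕ → ℕ) (hT1 : T 1 = 1) (hTmono : ∀ k, 1 ≤ k → T k < T (k + 1))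
    (hTrat : Tendsto (fun k => (T (k + 1) : ℝ) / (T k : ℝ)) atTop atTop)
    (a b : ℕ → ℝ) (ha : ∀ i, i < c₁ → 0 < a i ∧ a i < 1)
    (hb : ∀ j, j < c₂ → 0 < b j ∧ b j < 1)
    (hsa : ∑ i ∈ Finset.range c₁, a i = 1) (hsb : ∑ j ∈ Finset.range c₂, b j = 1)
    (μ : Measure (Omg c₁ c₂ T)) [IsProbabilityMeasure μ]
    (hμ : ∀ (n : ℕ) (w : Word c₁ c₂ T n),
      μ (cyl c₁ c₂ T n w) = ENNReal.ofReal (cylWeight c₁ c₂ T a b n w))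
    (q ε : ℝ) (hε : 0 < ε) :
    0 < Hmeas (μ.map (gammaMap c₁ c₂ T)) q
        (Filter.liminf (tauN c₁ c₂ T a b q) atTop - ε) (Set.Icc (0 : ℝ) 1) ∧
    Filter.liminf (tauN c₁ c₂ T a b q) atTop ≤ bFun (μ.map (gammaMap c₁ c₂ T)) q := by
  obtain ⟨p, hp0, hpP⟩ :=
    exists_pos_le_mixedWeight (T := T) (fun i hi => (ha i hi).1) fun j hj => (hb j hj).1
  have hP1 := sum_mixedWeight (T := T) hsa hsb
  have hd := two_le_Yc (T := T) hc₁ hc₂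
  have hc := Yc_le_max (c₁ := c₁) (c₂ := c₂) (T := T)
  have hm := measure_agreeOn_range hμ
  have hpos : ∀ t < liminf (tauN c₁ c₂ T a b q) atTop, ∃ G : Set (Omg c₁ c₂ T),
      0 < Hpre (μ.map radixValue) q t (radixValue '' G) := fun t ht => by
    obtain ⟨s, hts, hs⟩ := exists_between ht
    refine exists_Hpre_pos hd hc hp0 hpP hP1 hm (sub_pos.2 hts) ?_
    rw [add_sub_cancel]
    exact eventually_inv_prod_le hc₁ hc₂ hp0 hpP hP1 hs
  rw [gammaMap_eq_radixValue]
  constructor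
  · obtain ⟨G, hG⟩ := hpos _ (sub_lt_self _ hε)
    refine hG.trans_le (Hpre_le_Hmeas _ _ _ ?_)
    rintro _ ⟨x, -, rfl⟩
    exact radixValue_mem_Icc hd x
  · rw [bFun, msupport_map_radixValue hd fun n x => by
      rw [hm, ENNReal.ofReal_pos]
      exact Finset.prod_pos fun i _ => hp0.trans_le (hpP _ _)]
    refine le_csInf (exists_Hmeas_eq_zero hd hc hp0 hpP hm q) fun t ht => ?_
    by_contra! hlt
    obtain ⟨G, hG⟩ := hpos t hlt
    have h := hG.trans_le (Hpre_le_Hmeas _ _ _ (image_subset_range radixValue G))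
    exact h.ne' ht

end MF
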